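/- Rewriting identity for the dominating sum-rate constraint of the generalized compression scheme. Let U₁, U₂, X₀, X₁, X₂, Y₁, Y₂ be jointly distributed finite-valued random variables such that (U₁,U₂) — (X₀,X₁,X₂) — (Y₁,Y₂) forms a Markov chain. Then I(U₁; X₀,X₁,X₂ | Y₁) + I(U₂; U₁,X₀,X₁,X₂ | Y₂) = I(U₁,U₂; X₀,X₁,X₂) + I(U₁; U₂) − I(U₁; Y₁) − I(U₂; Y₂). -/

import Mathlib

open MeasureTheory

/-- Shannon entropy (in bits) of a finite-valued random variable `X` on `(Ω, μ)`:
`H(X) = −Σ_a P(X = a) · log₂ P(X = a)` (with the convention `0 · log₂ 0 = 0`). -/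
noncomputable def entH {Ω : Type*} [MeasurableSpace Ω] {α : Type*} [Fintype α]
    (μ : Measure Ω) (X : Ω → α) : ℝ :=
  -∑ a : α, (μ (X ⁻¹' {a})).toReal * Real.logb 2 (μ (X ⁻¹' {a})).toReal

/-- Conditional entropy `H(X | Y) = H(X, Y) − H(Y)`. -/
noncomputable def condEntH {Ω : Type*} [MeasurableSpace Ω] {α β : Type*} [Fintype α] [Fintype β]
    (μ : Measure Ω) (X : Ω → α) (Y : Ω → β) : ℝ :=
  entH μ (fun ω => (X ω, Y ω)) - entH μ Y

/-- Mutual information `I(X; Y) = H(X) + H(Y) − H(X, Y)`. -/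
noncomputable def miH {Ω : Type*} [MeasurableSpace Ω] {α β : Type*} [Fintype α] [Fintype β]
    (μ : Measure Ω) (X : Ω → α) (Y : Ω → β) : ℝ :=
  entH μ X + entH μ Y - entH μ (fun ω => (X ω, Y ω))

/-- Conditional mutual information `I(X; Y | Z) = H(X|Z) + H(Y|Z) − H(X,Y|Z)`. -/
noncomputable def cmiH {Ω : Type*} [MeasurableSpace Ω] {α β γ : Type*}
    [Fintype α] [Fintype β] [Fintype γ]
    (μ : Measure Ω) (X : Ω → α) (Y : Ω → β) (Z : Ω → γ) : ℝ :=
  condEntH μ X Z + condEntH μ Y Z - condEntH μ (fun ω => (X ω, Y ω)) Z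

section Entropy

variable {Ω : Type*} [MeasurableSpace Ω] {α β γ : Type*} [Fintype α] [MeasurableSpace α]
  [MeasurableSingletonClass α] (μ : Measure Ω) [IsFiniteMeasure μ]

open scoped Classical in
/-- The mass function of `f ∘ W` is the fibrewise sum of the mass function of `W`. -/
theorem measureReal_comp_preimage_singleton {W : Ω → α} (hW : Measurable W) (f : α → β) (b : β) :
    μ.real ((fun ω => f (W ω)) ⁻¹' {b}) = ∑ a with f a = b, μ.real (W ⁻¹' {a}) := by
  rw [sum_measureReal_preimage_singleton _ fun a _ => hW (measurableSet_singleton a)]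
  congr 1
  ext ω
  simp

variable [Fintype β]

/-- The entropy of `f ∘ W` as an expectation over the values of `W`. -/
theorem entH_comp {W : Ω → α} (hW : Measurable W) (f : α → β) :
    entH μ (fun ω => f (W ω)) =
      -∑ a, μ.real (W ⁻¹' {a}) * Real.logb 2 (μ.real ((fun ω => f (W ω)) ⁻¹' {f a})) := by
  classical
  change -∑ b, μ.real _ * Real.logb 2 (μ.real _) = _
  rw [← Finset.sum_fiberwise Finset.univ f]
  congr 1
  refine Finset.sum_congr rfl fun b _ => ?_
  nth_rewrite 1 [measureReal_comp_preimage_singleton μ hW f b]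
  rw [Finset.sum_mul]
  refine Finset.sum_congr rfl fun a ha => ?_
  rw [(Finset.mem_filter.mp ha).2]

/-- Entropy is invariant under injective relabelling. -/
theorem entH_comp_of_injective {W : Ω → α} (hW : Measurable W) {f : α → β}
    (hf : Function.Injective f) : entH μ (fun ω => f (W ω)) = entH μ W := by
  rw [entH_comp μ hW f]
  change _ = -∑ a, μ.real _ * Real.logb 2 (μ.real _)
  have h (a : α) : (fun ω => f (W ω)) ⁻¹' {f a} = W ⁻¹' {a} := by
    ext ω
    simp [hf.eq_iff]
  simp_rw [h]

variable [MeasurableSpace β] [MeasurableSingletonClass β] [Fintype γ] [MeasurableSpace γ]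
  [MeasurableSingletonClass γ]

/-- Summing a joint mass function over its first coordinate yields the second marginal. -/
theorem sum_measureReal_prodMk_preimage {V : Ω → α} {Z : Ω → γ} (hV : Measurable V)
    (hZ : Measurable Z) (c : γ) :
    ∑ a, μ.real ((fun ω => (V ω, Z ω)) ⁻¹' {(a, c)}) = μ.real (Z ⁻¹' {c}) := by
  classical
  have h := measureReal_comp_preimage_singleton μ (hV.prodMk hZ) Prod.snd c
  rw [Finset.sum_filter, Fintype.sum_prod_type] at h
  simpa using h.symm

theorem sub_mul_div_le_mul_log {q r s t : ℝ} (hq : 0 ≤ q) (hr : q ≤ r) (hs : q ≤ s) (ht : q ≤ t) :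
    q - s * t / r ≤ q * (Real.log q + Real.log r - Real.log s - Real.log t) := by
  rcases hq.eq_or_lt with rfl | hq
  · simp only [zero_sub, zero_mul, Left.neg_nonpos_iff]
    positivity
  have hr := hq.trans_le hr
  have hs := hq.trans_le hs
  have ht := hq.trans_le ht
  have h := Real.log_le_sub_one_of_pos (show 0 < s * t / (q * r) by positivity)
  rw [Real.log_div (by positivity) (by positivity), Real.log_mul hs.ne' ht.ne',
    Real.log_mul hq.ne' hr.ne'] at h
  have h' := mul_le_mul_of_nonneg_left h hq.le
  have e : q * (s * t / (q * r) - 1) = s * t / r - q := by field_simp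
  linarith

/-- Conditional mutual information is nonnegative. -/
theorem cmiH_nonneg {X : Ω → α} {Y : Ω → β} {Z : Ω → γ} (hX : Measurable X) (hY : Measurable Y)
    (hZ : Measurable Z) : 0 ≤ cmiH μ X Y Z := by
  have hW : Measurable fun ω => ((X ω, Y ω), Z ω) := (hX.prodMk hY).prodMk hZ
  set W := fun ω => ((X ω, Y ω), Z ω)
  set q := fun a => μ.real (W ⁻¹' {a})
  set r := fun c => μ.real (Z ⁻¹' {c})
  set s := fun a => μ.real ((fun ω => (X ω, Z ω)) ⁻¹' {a})
  set t := fun a => μ.real ((fun ω => (Y ω, Z ω)) ⁻¹' {a})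
  have eW : entH μ W = -∑ a, q a * Real.logb 2 (q a) := rfl
  have eZ : entH μ Z = -∑ a, q a * Real.logb 2 (r a.2) := entH_comp μ hW fun a => a.2
  have eXZ : entH μ (fun ω => (X ω, Z ω)) = -∑ a, q a * Real.logb 2 (s (a.1.1, a.2)) :=
    entH_comp μ hW fun a => (a.1.1, a.2)
  have eYZ : entH μ (fun ω => (Y ω, Z ω)) = -∑ a, q a * Real.logb 2 (t (a.1.2, a.2)) :=
    entH_comp μ hW fun a => (a.1.2, a.2)
  have sum_q : ∑ a, q a = ∑ c, r c := by
    rw [Fintype.sum_prod_type_right]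
    exact Finset.sum_congr rfl fun c _ => sum_measureReal_prodMk_preimage μ (hX.prodMk hY) hZ c
  have sum_st : ∑ a : (α × β) × γ, s (a.1.1, a.2) * t (a.1.2, a.2) / r a.2 = ∑ c, r c := by
    rw [Fintype.sum_prod_type_right]
    refine Finset.sum_congr rfl fun c _ => ?_
    simp only
    rw [← Finset.sum_div, Fintype.sum_prod_type]
    simp only
    rw [← Finset.sum_mul_sum, sum_measureReal_prodMk_preimage μ hX hZ c,
      sum_measureReal_prodMk_preimage μ hY hZ c, mul_self_div_self]
  have key : 0 ≤ ∑ a, q a * (Real.log (q a) + Real.log (r a.2) - Real.log (s (a.1.1, a.2))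
      - Real.log (t (a.1.2, a.2))) := by
    calc 0 = ∑ a, (q a - s (a.1.1, a.2) * t (a.1.2, a.2) / r a.2) := by
          rw [Finset.sum_sub_distrib, sum_q, sum_st, sub_self]
      _ ≤ _ := by
          refine Finset.sum_le_sum fun a _ => sub_mul_div_le_mul_log measureReal_nonneg ?_ ?_ ?_
          all_goals
            refine measureReal_mono fun ω hω => ?_
            obtain rfl : W ω = a := hω
            rfl
  have e : cmiH μ X Y Z = (∑ a, q a * (Real.log (q a) + Real.log (r a.2)
      - Real.log (s (a.1.1, a.2)) - Real.log (t (a.1.2, a.2)))) / Real.log 2 := by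
    change entH μ (fun ω => (X ω, Z ω)) - entH μ Z + (entH μ (fun ω => (Y ω, Z ω)) - entH μ Z)
      - (entH μ W - entH μ Z) = _
    rw [eW, eZ, eXZ, eYZ, Finset.sum_div]
    simp only [← Finset.sum_neg_distrib, ← Finset.sum_sub_distrib, ← Finset.sum_add_distrib]
    refine Finset.sum_congr rfl fun a _ => ?_
    simp only [Real.logb]
    ring
  rw [e]
  exact div_nonneg key (Real.log_nonneg one_le_two)

/-- Conditional mutual information is symmetric. -/
theorem cmiH_comm {X : Ω → α} {Y : Ω → β} {Z : Ω → γ} (hX : Measurable X) (hY : Measurable Y)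
    (hZ : Measurable Z) : cmiH μ X Y Z = cmiH μ Y X Z := by
  have h : entH μ (fun ω => ((Y ω, X ω), Z ω)) = entH μ (fun ω => ((X ω, Y ω), Z ω)) :=
    entH_comp_of_injective μ ((hX.prodMk hY).prodMk hZ) (f := fun a => ((a.1.2, a.1.1), a.2))
      (by rintro ⟨⟨_, _⟩, _⟩ ⟨⟨_, _⟩, _⟩; simp; tauto)
  unfold cmiH condEntH
  linarith

variable {δ : Type*} [Fintype δ] [MeasurableSpace δ] [MeasurableSingletonClass δ]

/-- The chain rule `I(A, B; Y | Z) = I(A; Y | Z) + I(B; Y | A, Z)`. -/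
theorem cmiH_chain {A : Ω → α} {B : Ω → β} {Y : Ω → δ} {Z : Ω → γ} (hA : Measurable A)
    (hB : Measurable B) (hY : Measurable Y) (hZ : Measurable Z) :
    cmiH μ (fun ω => (A ω, B ω)) Y Z =
      cmiH μ A Y Z + cmiH μ B Y (fun ω => (A ω, Z ω)) := by
  have h₁ : entH μ (fun ω => (B ω, (A ω, Z ω))) = entH μ (fun ω => ((A ω, B ω), Z ω)) :=
    entH_comp_of_injective μ ((hA.prodMk hB).prodMk hZ) (f := fun a => (a.1.2, (a.1.1, a.2)))
      (by rintro ⟨⟨_, _⟩, _⟩ ⟨⟨_, _⟩, _⟩; simp; tauto)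
  have h₂ : entH μ (fun ω => (Y ω, (A ω, Z ω))) = entH μ (fun ω => ((A ω, Y ω), Z ω)) :=
    entH_comp_of_injective μ ((hA.prodMk hY).prodMk hZ) (f := fun a => (a.1.2, (a.1.1, a.2)))
      (by rintro ⟨⟨_, _⟩, _⟩ ⟨⟨_, _⟩, _⟩; simp; tauto)
  have h₃ : entH μ (fun ω => ((B ω, Y ω), (A ω, Z ω))) =
      entH μ (fun ω => (((A ω, B ω), Y ω), Z ω)) :=
    entH_comp_of_injective μ (((hA.prodMk hB).prodMk hY).prodMk hZ)
      (f := fun a => ((a.1.1.2, a.1.2), (a.1.1.1, a.2)))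
      (by rintro ⟨⟨⟨_, _⟩, _⟩, _⟩ ⟨⟨⟨_, _⟩, _⟩, _⟩; simp; tauto)
  unfold cmiH condEntH
  linarith

/-- Conditional mutual information does not depend on the order within a pair. -/
theorem cmiH_prod_swap {A : Ω → α} {B : Ω → β} {Y : Ω → δ} {Z : Ω → γ} (hA : Measurable A)
    (hB : Measurable B) (hY : Measurable Y) (hZ : Measurable Z) :
    cmiH μ (fun ω => (B ω, A ω)) Y Z = cmiH μ (fun ω => (A ω, B ω)) Y Z := by
  have h₁ : entH μ (fun ω => ((B ω, A ω), Z ω)) = entH μ (fun ω => ((A ω, B ω), Z ω)) :=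
    entH_comp_of_injective μ ((hA.prodMk hB).prodMk hZ) (f := fun a => ((a.1.2, a.1.1), a.2))
      (by rintro ⟨⟨_, _⟩, _⟩ ⟨⟨_, _⟩, _⟩; simp; tauto)
  have h₂ : entH μ (fun ω => (((B ω, A ω), Y ω), Z ω)) =
      entH μ (fun ω => (((A ω, B ω), Y ω), Z ω)) :=
    entH_comp_of_injective μ (((hA.prodMk hB).prodMk hY).prodMk hZ)
      (f := fun a => (((a.1.1.2, a.1.1.1), a.1.2), a.2))
      (by rintro ⟨⟨⟨_, _⟩, _⟩, _⟩ ⟨⟨⟨_, _⟩, _⟩, _⟩; simp; tauto)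
  unfold cmiH condEntH
  linarith

/-- If `(U₁, U₂) — X — (Y₁, Y₂)` is a Markov chain, then
`I(U₁; X | Y₁) + I(U₂; U₁, X | Y₂) = I(U₁, U₂; X) + I(U₁; U₂) − I(U₁; Y₁) − I(U₂; Y₂)`. -/
theorem cmiH_add_cmiH_eq_of_markov {ε : Type*} [Fintype ε] [MeasurableSpace ε]
    [MeasurableSingletonClass ε] {U1 : Ω → α} {U2 : Ω → β} {X : Ω → γ} {Y1 : Ω → δ} {Y2 : Ω → ε}
    (hU1 : Measurable U1) (hU2 : Measurable U2) (hX : Measurable X) (hY1 : Measurable Y1)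
    (hY2 : Measurable Y2)
    (hMarkov : cmiH μ (fun ω => (U1 ω, U2 ω)) (fun ω => (Y1 ω, Y2 ω)) X = 0) :
    cmiH μ U1 X Y1 + cmiH μ U2 (fun ω => (U1 ω, X ω)) Y2 =
      miH μ (fun ω => (U1 ω, U2 ω)) X + miH μ U1 U2 - miH μ U1 Y1 - miH μ U2 Y2 := by
  have hY := hY1.prodMk hY2
  have hUX := hU1.prodMk hX
  rw [cmiH_chain μ hU1 hU2 hY hX, cmiH_comm μ hU1 hY hX, cmiH_comm μ hU2 hY hUX,
    ← cmiH_prod_swap μ hY1 hY2 hU2 hUX, cmiH_chain μ hY1 hY2 hU1 hX,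
    cmiH_chain μ hY2 hY1 hU2 hUX] at hMarkov
  have n₁ := cmiH_nonneg μ hY1 hU1 hX
  have n₂ := cmiH_nonneg μ hY2 hU1 (hY1.prodMk hX)
  have n₃ := cmiH_nonneg μ hY2 hU2 hUX
  have n₄ := cmiH_nonneg μ hY1 hU2 (hY2.prodMk hUX)
  have m₁ : cmiH μ Y1 U1 X = 0 := by linarith
  have m₂ : cmiH μ Y2 U2 (fun ω => (U1 ω, X ω)) = 0 := by linarith
  have e₁ : entH μ (fun ω => (Y1 ω, X ω)) =
      entH μ (fun ω => (X ω, Y1 ω)) :=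
    entH_comp_of_injective μ (hX.prodMk hY1) (f := Prod.swap) Prod.swap_injective
  have e₂ : entH μ (fun ω => ((Y1 ω, U1 ω), X ω)) =
      entH μ (fun ω => ((U1 ω, X ω), Y1 ω)) :=
    entH_comp_of_injective μ (hUX.prodMk hY1) (f := fun a => ((a.2, a.1.1), a.1.2))
      (by rintro ⟨⟨_, _⟩, _⟩ ⟨⟨_, _⟩, _⟩; simp; tauto)
  have e₃ : entH μ (fun ω => (Y2 ω, (U1 ω, X ω))) =
      entH μ (fun ω => ((U1 ω, X ω), Y2 ω)) :=
    entH_comp_of_injective μ (hUX.prodMk hY2) (f := Prod.swap) Prod.swap_injective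
  have e₄ : entH μ (fun ω => ((Y2 ω, U2 ω), (U1 ω, X ω))) =
      entH μ (fun ω => ((U2 ω, (U1 ω, X ω)), Y2 ω)) :=
    entH_comp_of_injective μ ((hU2.prodMk hUX).prodMk hY2) (f := fun a => ((a.2, a.1.1), a.1.2))
      (by rintro ⟨⟨_, _⟩, _⟩ ⟨⟨_, _⟩, _⟩; simp; tauto)
  have e₅ : entH μ (fun ω => (U2 ω, (U1 ω, X ω))) =
      entH μ (fun ω => ((U1 ω, U2 ω), X ω)) :=
    entH_comp_of_injective μ ((hU1.prodMk hU2).prodMk hX) (f := fun a => (a.1.2, (a.1.1, a.2)))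
      (by rintro ⟨⟨_, _⟩, _⟩ ⟨⟨_, _⟩, _⟩; simp; tauto)
  simp only [cmiH, condEntH, miH] at m₁ m₂ ⊢
  linarith

end Entropy

/-- Rewriting identity for the dominating sum-rate constraint of the generalized compression
scheme: if `(U₁,U₂) — (X₀,X₁,X₂) — (Y₁,Y₂)` forms a Markov chain, then
`I(U₁; X₀,X₁,X₂ | Y₁) + I(U₂; U₁,X₀,X₁,X₂ | Y₂)
  = I(U₁,U₂; X₀,X₁,X₂) + I(U₁; U₂) − I(U₁; Y₁) − I(U₂; Y₂)`. -/
theorem stmt_13 {Ω : Type*} [MeasurableSpace Ω] (μ : Measure Ω) [IsProbabilityMeasure μ]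
    {A1 A2 C0 C1 C2 D1 D2 : Type*}
    [Fintype A1] [Fintype A2] [Fintype C0] [Fintype C1] [Fintype C2] [Fintype D1] [Fintype D2]
    [MeasurableSpace A1] [MeasurableSingletonClass A1]
    [MeasurableSpace A2] [MeasurableSingletonClass A2]
    [MeasurableSpace C0] [MeasurableSingletonClass C0]
    [MeasurableSpace C1] [MeasurableSingletonClass C1]
    [MeasurableSpace C2] [MeasurableSingletonClass C2]
    [MeasurableSpace D1] [MeasurableSingletonClass D1]
    [MeasurableSpace D2] [MeasurableSingletonClass D2]
    (U1 : Ω → A1) (U2 : Ω → A2) (X0 : Ω → C0) (X1 : Ω → C1) (X2 : Ω → C2)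
    (Y1 : Ω → D1) (Y2 : Ω → D2)
    (hU1 : Measurable U1) (hU2 : Measurable U2) (hX0 : Measurable X0)
    (hX1 : Measurable X1) (hX2 : Measurable X2) (hY1 : Measurable Y1) (hY2 : Measurable Y2)
    (hMarkov : cmiH μ (fun ω => (U1 ω, U2 ω)) (fun ω => (Y1 ω, Y2 ω))
      (fun ω => (X0 ω, X1 ω, X2 ω)) = 0) :
    cmiH μ U1 (fun ω => (X0 ω, X1 ω, X2 ω)) Y1
      + cmiH μ U2 (fun ω => (U1 ω, X0 ω, X1 ω, X2 ω)) Y2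
    = miH μ (fun ω => (U1 ω, U2 ω)) (fun ω => (X0 ω, X1 ω, X2 ω))
      + miH μ U1 U2 - miH μ U1 Y1 - miH μ U2 Y2 := by
  exact cmiH_add_cmiH_eq_of_markov μ hU1 hU2 (hX0.prodMk (hX1.prodMk hX2)) hY1 hY2 hMarkov
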